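/- Let μ, κ, γ, M₀ > 0, let (P,γ) be an admissible pair with pressure potential W, and let (ρ,u,c) be a smooth periodic solution of the non-local Navier–Stokes–Korteweg system on [0,∞) with initial data (ρ₀,u₀) satisfying M₀⁻¹ ≤ ρ₀(x) ≤ M₀ for all x. Define K_{P_γ} := max_{λ∈[(2M₀)⁻¹, 2M₀]} |P_γ(λ)|, Σ₀ := μ·∂_x u₀ − P_γ(ρ₀), Σ := μ·∂_x u − P_γ(ρ), and K_u := (8/μ²)·(2 + 5·M₀·μ)·(‖Σ₀‖²_{L²(𝕋)} + 1 + K²_{P_γ}). Suppose that for some T̃₀ ∈ (0,1): (2M₀)⁻¹ ≤ ρ(t,x) ≤ 2M₀ on [0,T̃₀] × ℝ and sup_{t∈[0,T̃₀]} ‖∂_x u(t,·)‖²_{L²(𝕋)} + ∫₀^{T̃₀} ‖∂_x Σ(t,·)‖²_{L²(𝕋)} dt ≤ K_u. Then there exists a time T_u > 0, depending only on M₀, ‖u₀‖_{H¹(𝕋)}, μ, γ, κ, P and W, such that if T̃₀ < T_u, then sup_{t∈[0,T̃₀]} ‖∂_x u(t,·)‖²_{L²(𝕋)} + ∫₀^{T̃₀}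 ‖∂_x Σ(t,·)‖²_{L²(𝕋)} dt ≤ (4/μ²)·(2 + 5·M₀·μ)·(‖Σ₀‖²_{L²(𝕋)} + 1 + K²_{P_γ}). -/

import Mathlib

open MeasureTheory Filter Set

/-- The `L²` norm of a `1`-periodic function, computed over one period. -/
noncomputable def L2norm (f : ℝ → ℝ) : ℝ := Real.sqrt (∫ x in (0:ℝ)..1, f x ^ 2)

/-- The `H¹` norm of a `1`-periodic function, computed over one period. -/
noncomputable def H1norm (f : ℝ → ℝ) : ℝ :=
  Real.sqrt (∫ x in (0:ℝ)..1, f x ^ 2 + deriv f x ^ 2)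

/-- The `H²` norm of a `1`-periodic function, computed over one period. -/
noncomputable def H2norm (f : ℝ → ℝ) : ℝ :=
  Real.sqrt (∫ x in (0:ℝ)..1, f x ^ 2 + deriv f x ^ 2 + deriv (deriv f) x ^ 2)

/-- The sup-norm of a `1`-periodic function, computed over one period. -/
noncomputable def LinfNorm (f : ℝ → ℝ) : ℝ := sSup ((fun x => |f x|) '' Set.Icc (0:ℝ) 1)

/-- The `W^{1,∞}` norm of a `1`-periodic function. -/
noncomputable def W1infNorm (f : ℝ → ℝ) : ℝ := LinfNorm f + LinfNorm (deriv f)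

/-- The artificial pressure `P_γ(r) = P(r) + (γ/2) r²`. -/
noncomputable def artificialPressure (P : ℝ → ℝ) (γ : ℝ) (r : ℝ) : ℝ := P r + γ / 2 * r ^ 2

/-- A pair `(P, γ)` is admissible (with exponent `β` and limit `a`). -/
structure IsAdmissiblePair (P : ℝ → ℝ) (γ β a : ℝ) : Prop where
  gamma_pos : 0 < γ
  beta_ge : 2 ≤ β
  a_pos : 0 < a
  nonneg : ∀ r, 0 ≤ r → 0 ≤ P r
  smooth : ContDiffOn ℝ 1 P (Set.Ici 0)
  zero : P 0 = 0
  lim : Filter.Tendsto (fun r => deriv P r / r ^ (β - 1)) Filter.atTop (nhds a)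
  mono : MonotoneOn (artificialPressure P γ) (Set.Ici 0)

/-- `W` is a pressure potential for `P`: `W : [0,∞) → [0,∞)`, twice continuously
differentiable on `(0,∞)`, with `W''(r)·r = P'(r)` for `r > 0`. -/
structure IsPressurePotential (P W : ℝ → ℝ) : Prop where
  nonneg : ∀ r, 0 ≤ r → 0 ≤ W r
  smooth : ContDiffOn ℝ 2 W (Set.Ioi 0)
  relation : ∀ r : ℝ, 0 < r → deriv (deriv W) r * r = deriv P r

/-- A smooth `1`-periodic-in-space solution of the non-local Navier–Stokes–Korteweg
system on the time set `S`, with initial data `(ρ₀, u₀)`. -/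
structure IsNSKSolution (μ κ γ : ℝ) (P : ℝ → ℝ) (S : Set ℝ)
    (ρ u c : ℝ → ℝ → ℝ) (ρ₀ u₀ : ℝ → ℝ) : Prop where
  smooth_rho : ContDiffOn ℝ (⊤ : ℕ∞) (fun p : ℝ × ℝ => ρ p.1 p.2) (S ×ˢ (Set.univ : Set ℝ))
  smooth_u : ContDiffOn ℝ (⊤ : ℕ∞) (fun p : ℝ × ℝ => u p.1 p.2) (S ×ˢ (Set.univ : Set ℝ))
  smooth_c : ContDiffOn ℝ (⊤ : ℕ∞) (fun p : ℝ × ℝ => c p.1 p.2) (S ×ˢ (Set.univ : Set ℝ))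
  periodic_rho : ∀ t x, ρ t (x + 1) = ρ t x
  periodic_u : ∀ t x, u t (x + 1) = u t x
  periodic_c : ∀ t x, c t (x + 1) = c t x
  rho_pos : ∀ t x, 0 < ρ t x
  mass : ∀ t ∈ S, ∀ x : ℝ,
    deriv (fun s => ρ s x) t + deriv (fun y => ρ t y * u t y) x = 0
  momentum : ∀ t ∈ S, ∀ x : ℝ,
    deriv (fun s => ρ s x * u s x) t
      + deriv (fun y => ρ t y * u t y ^ 2) x
      + deriv (fun y => P (ρ t y)) x
      - μ * deriv (deriv (u t)) x
      - γ * ρ t x * deriv (fun y => c t y - ρ t y) x = 0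
  elliptic : ∀ t ∈ S, ∀ x : ℝ,
    -κ * deriv (deriv (c t)) x + γ * (c t x - ρ t x) = 0
  init_rho : ∀ x, ρ 0 x = ρ₀ x
  init_u : ∀ x, u 0 x = u₀ x

open scoped Topology ContDiff

/-! ### Functions of time and space that are smooth up to the initial time -/

section SpaceTime

variable {f : ℝ → ℝ → ℝ} {I : Set ℝ}

theorem hasDerivAt_space_fderivWithin
    (hf : ContDiffOn ℝ ∞ (fun p : ℝ × ℝ => f p.1 p.2) (I ×ˢ univ)) {t : ℝ} (ht : t ∈ I) (x : ℝ) :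
    HasDerivAt (f t)
      (fderivWithin ℝ (fun p : ℝ × ℝ => f p.1 p.2) (I ×ˢ univ) (t, x) (0, 1)) x := by
  have hd : HasFDerivWithinAt (fun p : ℝ × ℝ => f p.1 p.2) _ (I ×ˢ univ) (t, x) :=
    (hf.differentiableOn (by simp) (t, x) ⟨ht, mem_univ _⟩).hasFDerivWithinAt
  have hc : HasDerivWithinAt (fun y : ℝ => (t, y)) ((0 : ℝ), (1 : ℝ)) univ x :=
    ((hasDerivAt_const x t).prodMk (hasDerivAt_id x)).hasDerivWithinAt
  exact (hd.comp_hasDerivWithinAt x hc fun y _ => ⟨ht, mem_univ _⟩).hasDerivAt univ_mem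

theorem hasDerivAt_space
    (hf : ContDiffOn ℝ ∞ (fun p : ℝ × ℝ => f p.1 p.2) (I ×ˢ univ)) {t : ℝ} (ht : t ∈ I) (x : ℝ) :
    HasDerivAt (f t) (deriv (f t) x) x :=
  (hasDerivAt_space_fderivWithin hf ht x).differentiableAt.hasDerivAt

theorem contDiffOn_deriv_space (hI : UniqueDiffOn ℝ I)
    (hf : ContDiffOn ℝ ∞ (fun p : ℝ × ℝ => f p.1 p.2) (I ×ˢ univ)) :
    ContDiffOn ℝ ∞ (fun p : ℝ × ℝ => deriv (f p.1) p.2) (I ×ˢ univ) := by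
  have h : ContDiffOn ℝ ∞ (fderivWithin ℝ (fun p : ℝ × ℝ => f p.1 p.2) (I ×ˢ univ)) (I ×ˢ univ) :=
    hf.fderivWithin (hI.prod uniqueDiffOn_univ) (by simp)
  refine (h.clm_apply (contDiffOn_const (c := ((0 : ℝ), (1 : ℝ))))).congr fun p hp => ?_
  exact (hasDerivAt_space_fderivWithin hf hp.1 p.2).deriv

theorem hasDerivAt_time_fderiv (hI : IsOpen I)
    (hf : ContDiffOn ℝ ∞ (fun p : ℝ × ℝ => f p.1 p.2) (I ×ˢ univ)) {t : ℝ} (ht : t ∈ I) (x : ℝ) :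
    HasDerivAt (fun s => f s x) (fderiv ℝ (fun p : ℝ × ℝ => f p.1 p.2) (t, x) (1, 0)) t := by
  have hd : HasFDerivAt (fun p : ℝ × ℝ => f p.1 p.2) _ (t, x) :=
    ((hf.differentiableOn (by simp) (t, x) ⟨ht, mem_univ _⟩).differentiableAt
      ((hI.prod isOpen_univ).mem_nhds ⟨ht, mem_univ _⟩)).hasFDerivAt
  have hc : HasDerivAt (fun s : ℝ => (s, x)) ((1 : ℝ), (0 : ℝ)) t :=
    (hasDerivAt_id t).prodMk (hasDerivAt_const t x)
  exact hd.comp_hasDerivAt t hc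

theorem hasDerivAt_time (hI : IsOpen I)
    (hf : ContDiffOn ℝ ∞ (fun p : ℝ × ℝ => f p.1 p.2) (I ×ˢ univ)) {t : ℝ} (ht : t ∈ I) (x : ℝ) :
    HasDerivAt (fun s => f s x) (deriv (fun s => f s x) t) t :=
  (hasDerivAt_time_fderiv hI hf ht x).differentiableAt.hasDerivAt

theorem contDiffOn_deriv_time (hI : IsOpen I)
    (hf : ContDiffOn ℝ ∞ (fun p : ℝ × ℝ => f p.1 p.2) (I ×ˢ univ)) :
    ContDiffOn ℝ ∞ (fun p : ℝ × ℝ => deriv (fun s => f s p.2) p.1) (I ×ˢ univ) := by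
  have h : ContDiffOn ℝ ∞ (fderiv ℝ (fun p : ℝ × ℝ => f p.1 p.2)) (I ×ˢ univ) :=
    hf.fderiv_of_isOpen (hI.prod isOpen_univ) (by simp)
  refine (h.clm_apply (contDiffOn_const (c := ((1 : ℝ), (0 : ℝ))))).congr fun p hp => ?_
  exact (hasDerivAt_time_fderiv hI hf hp.1 p.2).deriv

theorem deriv_time_deriv_space (hI : IsOpen I)
    (hf : ContDiffOn ℝ ∞ (fun p : ℝ × ℝ => f p.1 p.2) (I ×ˢ univ)) {t : ℝ} (ht : t ∈ I) (x : ℝ) :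
    deriv (fun s => deriv (f s) x) t = deriv (fun y => deriv (fun s => f s y) t) x := by
  set F : ℝ × ℝ → ℝ := fun p => f p.1 p.2 with hF
  have hO : IsOpen (I ×ˢ (univ : Set ℝ)) := hI.prod isOpen_univ
  have hmem : (t, x) ∈ I ×ˢ (univ : Set ℝ) := ⟨ht, mem_univ _⟩
  have hd : HasFDerivAt (fderiv ℝ F) (fderiv ℝ (fderiv ℝ F) (t, x)) (t, x) := by
    have h : ContDiffOn ℝ ∞ (fderiv ℝ F) (I ×ˢ univ) := hf.fderiv_of_isOpen hO (by simp)
    exact ((h.differentiableOn (by simp) (t, x) hmem).differentiableAt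
      (hO.mem_nhds hmem)).hasFDerivAt
  have hs : IsSymmSndFDerivAt ℝ F (t, x) :=
    (hf.contDiffAt (hO.mem_nhds hmem)).isSymmSndFDerivAt (by
      rw [minSmoothness_of_isRCLikeNormedField]; exact WithTop.coe_le_coe.2 le_top)
  have hv : ∀ v : ℝ × ℝ, HasFDerivAt (fun p => fderiv ℝ F p v)
      ((ContinuousLinearMap.apply ℝ ℝ v).comp (fderiv ℝ (fderiv ℝ F) (t, x))) (t, x) :=
    fun v => (ContinuousLinearMap.apply ℝ ℝ v).hasFDerivAt.comp (t, x) hd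
  have h1 : HasDerivAt (fun s => fderiv ℝ F (s, x) (0, 1))
      (fderiv ℝ (fderiv ℝ F) (t, x) (1, 0) (0, 1)) t := by
    have hc : HasDerivAt (fun s : ℝ => (s, x)) ((1 : ℝ), (0 : ℝ)) t :=
      (hasDerivAt_id t).prodMk (hasDerivAt_const t x)
    exact (hv (0, 1)).comp_hasDerivAt t hc
  have h2 : HasDerivAt (fun y => fderiv ℝ F (t, y) (1, 0))
      (fderiv ℝ (fderiv ℝ F) (t, x) (0, 1) (1, 0)) x := by
    have hc : HasDerivAt (fun y : ℝ => (t, y)) ((0 : ℝ), (1 : ℝ)) x :=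
      (hasDerivAt_const x t).prodMk (hasDerivAt_id x)
    exact (hv (1, 0)).comp_hasDerivAt x hc
  have e1 : (fun s => deriv (f s) x) =ᶠ[𝓝 t] fun s => fderiv ℝ F (s, x) (0, 1) := by
    filter_upwards [hI.mem_nhds ht] with s hs
    rw [(hasDerivAt_space_fderivWithin hf hs x).deriv, fderivWithin_of_isOpen hO ⟨hs, mem_univ _⟩]
  have e2 : (fun y => deriv (fun s => f s y) t) = fun y => fderiv ℝ F (t, y) (1, 0) :=
    funext fun y => (hasDerivAt_time_fderiv hI hf ht y).deriv
  rw [e1.deriv_eq, e2, h1.deriv, h2.deriv, hs]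

/-- The integral over one period depends continuously on time. -/
theorem continuousOn_integral_period (hf : ContinuousOn (fun p : ℝ × ℝ => f p.1 p.2)
    (Ici 0 ×ˢ univ)) : ContinuousOn (fun t => ∫ x in (0 : ℝ)..1, f t x) (Ici 0) := by
  have hc : Continuous (fun p : ℝ × ℝ => f (max p.1 0) p.2) :=
    hf.comp_continuous (f := fun p : ℝ × ℝ => (max p.1 0, p.2)) (by fun_prop)
      fun p => ⟨mem_Ici.2 (le_max_right _ _), mem_univ _⟩
  have := intervalIntegral.continuous_parametric_intervalIntegral_of_continuous'
    (μ := volume) (f := fun t x => f (max t 0) x) hc 0 1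
  refine this.continuousOn.congr fun t ht => ?_
  simp only [max_eq_left (mem_Ici.1 ht)]

theorem continuous_slice {I : Set ℝ} (hf : ContinuousOn (fun p : ℝ × ℝ => f p.1 p.2) (I ×ˢ univ))
    {t : ℝ} (ht : t ∈ I) : Continuous (f t) :=
  hf.comp_continuous (f := fun x : ℝ => (t, x)) (by fun_prop) fun _ => ⟨ht, mem_univ _⟩

/-- Differentiation under the integral over one period. -/
theorem hasDerivAt_integral_period {f' : ℝ → ℝ → ℝ}
    (hf : ContinuousOn (fun p : ℝ × ℝ => f p.1 p.2) (Ioi 0 ×ˢ univ))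
    (hf' : ContinuousOn (fun p : ℝ × ℝ => f' p.1 p.2) (Ioi 0 ×ˢ univ))
    (hd : ∀ t, 0 < t → ∀ x, HasDerivAt (fun s => f s x) (f' t x) t) {t : ℝ} (ht : 0 < t) :
    HasDerivAt (fun s => ∫ x in (0 : ℝ)..1, f s x) (∫ x in (0 : ℝ)..1, f' t x) t := by
  obtain ⟨C, hC⟩ := (isCompact_Icc (a := t / 2) (b := t + 1)).prod
    (isCompact_Icc (a := (0 : ℝ)) (b := 1)) |>.exists_bound_of_continuousOn
      (hf'.mono (prod_mono (fun s hs => lt_of_lt_of_le (by positivity) hs.1) (subset_univ _)))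
  have hnhds : Icc (t / 2) (t + 1) ∈ 𝓝 t := Icc_mem_nhds (by linarith) (by linarith)
  refine (intervalIntegral.hasDerivAt_integral_of_dominated_loc_of_deriv_le (bound := fun _ => C)
    hnhds ?_ ?_ ?_ ?_ ?_ ?_).2
  · filter_upwards [Ioi_mem_nhds ht] with s hs
    exact (continuous_slice hf hs).aestronglyMeasurable
  · exact (continuous_slice hf ht).intervalIntegrable _ _
  · exact (continuous_slice hf' ht).aestronglyMeasurable
  · refine ae_of_all _ fun x hx s hs => hC (s, x) ⟨hs, ?_⟩
    rw [uIoc_of_le zero_le_one] at hx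
    exact ⟨hx.1.le, hx.2⟩
  · exact intervalIntegrable_const
  · exact ae_of_all _ fun x _ s hs => hd s (lt_of_lt_of_le (by positivity) hs.1) x

end SpaceTime

theorem deriv_periodic {g : ℝ → ℝ} (hg : ∀ x, g (x + 1) = g x) (x : ℝ) :
    deriv g (x + 1) = deriv g x := by
  rw [← deriv_comp_add_const, funext hg]

theorem integral_deriv_periodic_eq_zero {g g' : ℝ → ℝ} (hg : ∀ x, g (x + 1) = g x)
    (hd : ∀ x, HasDerivAt g (g' x) x) (hc : Continuous g') : ∫ x in (0 : ℝ)..1, g' x = 0 := by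
  rw [intervalIntegral.integral_eq_sub_of_hasDerivAt (fun x _ => hd x)
    (hc.intervalIntegrable _ _)]
  have := hg 0
  rw [zero_add] at this
  rw [this, sub_self]

theorem L2norm_sq (f : ℝ → ℝ) : L2norm f ^ 2 = ∫ x in (0 : ℝ)..1, f x ^ 2 :=
  Real.sq_sqrt (intervalIntegral.integral_nonneg zero_le_one fun _ _ => sq_nonneg _)

/-- One-dimensional Sobolev bound on the unit interval. -/
theorem sq_le_two_mul_integral_add {g g' : ℝ → ℝ} (hd : ∀ x, HasDerivAt g (g' x) x)
    (hc : Continuous g') {x : ℝ} (hx : x ∈ Icc (0 : ℝ) 1) :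
    g x ^ 2 ≤ 2 * (∫ y in (0 : ℝ)..1, g y ^ 2) + 2 * ∫ y in (0 : ℝ)..1, g' y ^ 2 := by
  have hg : Continuous g := continuous_iff_continuousAt.2 fun x => (hd x).continuousAt
  have key : ∀ y ∈ Icc (0 : ℝ) 1, g x ^ 2 ≤ 2 * g y ^ 2 + 2 * ∫ z in (0 : ℝ)..1, g' z ^ 2 := by
    intro y hy
    have h1 : g x - g y = ∫ z in y..x, g' z :=
      (intervalIntegral.integral_eq_sub_of_hasDerivAt (fun z _ => hd z)
        (hc.intervalIntegrable _ _)).symm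
    have h2 : |g x - g y| ≤ ∫ z in (0 : ℝ)..1, |g' z| := by
      rw [h1]
      refine (intervalIntegral.norm_integral_le_abs_integral_norm (f := g')).trans ?_
      refine (intervalIntegral.abs_integral_mono_interval (c := 0) (d := 1) ?_
        (ae_of_all _ fun _ => norm_nonneg _) (hc.norm.intervalIntegrable _ _)).trans_eq
        (abs_of_nonneg (intervalIntegral.integral_nonneg zero_le_one fun _ _ => norm_nonneg _))
      rw [uIoc_of_le zero_le_one]
      exact Ioc_subset_Ioc (le_min hy.1 hx.1) (max_le hy.2 hx.2)
    have h3 : (∫ z in (0 : ℝ)..1, |g' z|) ^ 2 ≤ ∫ z in (0 : ℝ)..1, g' z ^ 2 := by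
      set m := ∫ z in (0 : ℝ)..1, |g' z|
      have : 0 ≤ ∫ z in (0 : ℝ)..1, (|g' z| - m) ^ 2 :=
        intervalIntegral.integral_nonneg zero_le_one fun _ _ => sq_nonneg _
      have e : ∀ z, (|g' z| - m) ^ 2 = g' z ^ 2 - (2 * m) * |g' z| + m ^ 2 := fun z => by
        rw [sub_sq, sq_abs]; ring
      simp only [e] at this
      rw [intervalIntegral.integral_add, intervalIntegral.integral_sub,
        intervalIntegral.integral_const_mul, intervalIntegral.integral_const] at this
      · change _ ≤ _ - 2 * m * m + _ at this
        simp at this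
        linarith
      all_goals exact Continuous.intervalIntegrable (by fun_prop) _ _
    have h4 : (g x - g y) ^ 2 ≤ ∫ z in (0 : ℝ)..1, g' z ^ 2 := by
      rw [← sq_abs]
      exact (pow_le_pow_left₀ (abs_nonneg _) h2 2).trans h3
    nlinarith [sq_nonneg (g x - 2 * g y)]
  have := intervalIntegral.integral_mono_on (μ := volume) zero_le_one
    (f := fun _ => g x ^ 2) (g := fun y => 2 * g y ^ 2 + 2 * ∫ z in (0 : ℝ)..1, g' z ^ 2)
    (Continuous.intervalIntegrable (by fun_prop) _ _)
    (Continuous.intervalIntegrable (by fun_prop) _ _) key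
  rw [intervalIntegral.integral_add (Continuous.intervalIntegrable (by fun_prop) _ _)
    (Continuous.intervalIntegrable (by fun_prop) _ _), intervalIntegral.integral_const_mul] at this
  simpa using this

/-! ### The spatial estimates at a fixed time -/

theorem integral_sq_deriv_elliptic_le {κ γ M : ℝ} (hκ : 0 < κ) (hγ : 0 < γ)
    {r c c' c'' : ℝ → ℝ} (hr0 : ∀ x, 0 ≤ r x) (hrM : ∀ x, r x ≤ 2 * M)
    (hc : ∀ x, HasDerivAt c (c' x) x) (hc' : ∀ x, HasDerivAt c' (c'' x) x)
    (hc'' : Continuous c'') (hper : ∀ x, c (x + 1) = c x) (hper' : ∀ x, c' (x + 1) = c' x)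
    (heq : ∀ x, -κ * c'' x + γ * (c x - r x) = 0) :
    ∫ x in (0 : ℝ)..1, c' x ^ 2 ≤ γ * M ^ 2 / κ := by
  have cc : Continuous c := continuous_iff_continuousAt.2 fun x => (hc x).continuousAt
  have cc' : Continuous c' := continuous_iff_continuousAt.2 fun x => (hc' x).continuousAt
  have h0 : ∫ x in (0 : ℝ)..1, (c' x * c' x + c x * c'' x) = 0 :=
    integral_deriv_periodic_eq_zero (g := fun x => c x * c' x)
      (fun x => by simp only [hper, hper']) (fun x => (hc x).mul (hc' x)) (by fun_prop)
  have hle : ∀ x ∈ Icc (0 : ℝ) 1,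
      c' x ^ 2 ≤ γ * M ^ 2 / κ + (c' x * c' x + c x * c'' x) := by
    intro x _
    have e : c'' x = γ * (c x - r x) / κ := by
      rw [eq_div_iff hκ.ne']; linarith [heq x]
    have h1 : 0 ≤ M ^ 2 + c x * (c x - r x) := by
      nlinarith [sq_nonneg (c x - r x / 2), hr0 x, hrM x]
    have h2 : 0 ≤ γ / κ * (M ^ 2 + c x * (c x - r x)) := by positivity
    have h3 : γ / κ * (M ^ 2 + c x * (c x - r x)) = γ * M ^ 2 / κ + c x * c'' x := by
      rw [e]; ring
    nlinarith
  have := intervalIntegral.integral_mono_on (μ := volume) zero_le_one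
    (Continuous.intervalIntegrable (by fun_prop) _ _)
    (Continuous.intervalIntegrable (by fun_prop) _ _) hle
  rw [intervalIntegral.integral_add (Continuous.intervalIntegrable (by fun_prop) _ _)
    (Continuous.intervalIntegrable (by fun_prop) _ _), h0] at this
  simpa using this

/-- The constant in the differential inequality for the `L²` norm of the effective flux. -/
noncomputable def fluxRate (μ κ γ M Q N L : ℝ) : ℝ :=
  4 * M * μ * γ ^ 2 * (γ * M ^ 2 / κ) + 2 * M / μ * (2 * μ * N + (N + L) / 2) ^ 2
    + μ / (4 * M) * L + Q * (N + L)

/-- Bound for the production of the `L²` norm of the effective flux `S` at a fixed time. Here `r`,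
`v`, `w`, `c` are the density, the velocity, its space derivative and the order parameter, `b` is
the time derivative of the velocity, and `q` is the derivative of the artificial pressure at `r`. -/
theorem integral_flux_production_le {μ κ γ M Q N L : ℝ} (hμ : 0 < μ) (hκ : 0 < κ) (hγ : 0 < γ)
    (hM : 0 < M) {r q v w w' S S' b b' c c' c'' : ℝ → ℝ}
    (hr0 : ∀ x, 0 < r x) (hrM : ∀ x, r x ≤ 2 * M) (hQ : ∀ x, |q x * r x| ≤ Q)
    (cr : Continuous r) (cq : Continuous q)
    (hv : ∀ x, HasDerivAt v (w x) x) (hw : ∀ x, HasDerivAt w (w' x) x) (cw' : Continuous w')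
    (hS : ∀ x, HasDerivAt S (S' x) x) (cS' : Continuous S')
    (hb : ∀ x, HasDerivAt b (b' x) x) (cb' : Continuous b')
    (hc : ∀ x, HasDerivAt c (c' x) x) (hc' : ∀ x, HasDerivAt c' (c'' x) x) (cc'' : Continuous c'')
    (pv : ∀ x, v (x + 1) = v x) (pw : ∀ x, w (x + 1) = w x) (pS : ∀ x, S (x + 1) = S x)
    (pb : ∀ x, b (x + 1) = b x) (pc : ∀ x, c (x + 1) = c x) (pc' : ∀ x, c' (x + 1) = c' x)
    (hell : ∀ x, -κ * c'' x + γ * (c x - r x) = 0)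
    (hmom : ∀ x, r x * (b x + v x * w x) = S' x + γ * r x * c' x)
    (hN : ∫ x in (0 : ℝ)..1, w x ^ 2 ≤ N) (hL : ∫ x in (0 : ℝ)..1, S x ^ 2 ≤ L) :
    ∫ x in (0 : ℝ)..1, 2 * S x * (μ * b' x + q x * r x * w x + v x * (μ * w' x - S' x))
      ≤ -(μ / (2 * M)) * (∫ x in (0 : ℝ)..1, S' x ^ 2) + fluxRate μ κ γ M Q N L := by
  have cv : Continuous v := continuous_iff_continuousAt.2 fun x => (hv x).continuousAt
  have cw : Continuous w := continuous_iff_continuousAt.2 fun x => (hw x).continuousAt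
  have cS : Continuous S := continuous_iff_continuousAt.2 fun x => (hS x).continuousAt
  have cb : Continuous b := continuous_iff_continuousAt.2 fun x => (hb x).continuousAt
  have cc' : Continuous c' := continuous_iff_continuousAt.2 fun x => (hc' x).continuousAt
  have hE := integral_sq_deriv_elliptic_le (M := M) hκ hγ (fun x => (hr0 x).le) hrM hc hc' cc''
    pc pc' hell
  have hQ0 : 0 ≤ Q := (abs_nonneg _).trans (hQ 0)
  set G := ∫ x in (0 : ℝ)..1, S' x ^ 2 with hG
  set B := √(2 * L + 2 * G) with hB
  have hB2 : ∀ x ∈ Icc (0 : ℝ) 1, S x ^ 2 ≤ 2 * L + 2 * G := fun x hx => by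
    have := sq_le_two_mul_integral_add hS cS' hx
    rw [← hG] at this
    linarith
  have hBsq : B ^ 2 = 2 * L + 2 * G :=
    Real.sq_sqrt ((sq_nonneg _).trans (hB2 0 ⟨le_rfl, zero_le_one⟩))
  have hSB : ∀ x ∈ Icc (0 : ℝ) 1, |S x| ≤ B := fun x hx =>
    Real.abs_le_sqrt (hB2 x hx)
  have hB0 : 0 ≤ B := Real.sqrt_nonneg _
  set H' : ℝ → ℝ := fun x => 2 * μ * (S' x * (b x + v x * w x)
    + S x * (b' x + (w x * w x + v x * w' x))) - (w x * S x ^ 2 + v x * (2 * S x * S' x)) with hH'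
  have cH' : Continuous H' := by fun_prop
  have h0 : ∫ x in (0 : ℝ)..1, H' x = 0 := by
    refine integral_deriv_periodic_eq_zero
      (g := fun x => 2 * μ * (S x * (b x + v x * w x)) - v x * S x ^ 2)
      (fun x => by simp only [pS, pb, pv, pw]) (fun x => ?_) cH'
    have h := (((hS x).mul ((hb x).add ((hv x).mul (hw x)))).const_mul (2 * μ)).sub
      ((hv x).mul ((hS x).pow 2))
    refine h.congr_deriv ?_
    simp [hH']
  have hpt : ∀ x ∈ Icc (0 : ℝ) 1,
      2 * S x * (μ * b' x + q x * r x * w x + v x * (μ * w' x - S' x))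
        ≤ -(3 * μ / (4 * M)) * S' x ^ 2 + 4 * M * μ * γ ^ 2 * c' x ^ 2
          + (2 * μ * B + B / 2 + Q) * w x ^ 2 + (B / 2 + Q) * S x ^ 2 + H' x := by
    intro x hx
    have hr := hr0 x
    have e : b x + v x * w x = S' x / r x + γ * c' x := by
      field_simp; linarith [hmom x]
    have e1 : 2 * S x * (μ * b' x + q x * r x * w x + v x * (μ * w' x - S' x))
        = -(2 * μ) * (S' x ^ 2 / r x) - 2 * μ * γ * S' x * c' x - 2 * μ * S x * w x ^ 2
          + w x * S x ^ 2 + 2 * S x * (q x * r x) * w x + H' x := by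
      simp only [hH', e]; ring
    have i1 : S' x ^ 2 / (2 * M) ≤ S' x ^ 2 / r x :=
      div_le_div_of_nonneg_left (sq_nonneg _) hr (hrM x)
    have i2 : -(2 * μ * γ * S' x * c' x)
        ≤ μ / (4 * M) * S' x ^ 2 + 4 * M * μ * γ ^ 2 * c' x ^ 2 := by
      have : 0 ≤ μ / (4 * M) * (S' x + 4 * M * γ * c' x) ^ 2 := by positivity
      have e2 : μ / (4 * M) * (S' x + 4 * M * γ * c' x) ^ 2 = μ / (4 * M) * S' x ^ 2
          + 2 * μ * γ * S' x * c' x + 4 * M * μ * γ ^ 2 * c' x ^ 2 := by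
        field_simp; ring
      linarith
    have hs := abs_le.1 (hSB x hx)
    have i3 : -(2 * μ * S x * w x ^ 2) ≤ 2 * μ * B * w x ^ 2 := by
      have : 0 ≤ 2 * μ * w x ^ 2 * (B + S x) := mul_nonneg (by positivity) (by linarith)
      linarith
    have young : |S x| * |w x| ≤ (w x ^ 2 + S x ^ 2) / 2 := by
      rw [← sq_abs (w x), ← sq_abs (S x)]
      linarith [sq_nonneg (|S x| - |w x|)]
    have i4 : w x * S x ^ 2 ≤ B / 2 * w x ^ 2 + B / 2 * S x ^ 2 := by
      calc w x * S x ^ 2 ≤ |w x * S x ^ 2| := le_abs_self _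
        _ = |S x| * (|S x| * |w x|) := by rw [abs_mul, abs_pow]; ring
        _ ≤ B * ((w x ^ 2 + S x ^ 2) / 2) := by
          gcongr
          exact hSB x hx
        _ = _ := by ring
    have i5 : 2 * S x * (q x * r x) * w x ≤ Q * w x ^ 2 + Q * S x ^ 2 := by
      calc 2 * S x * (q x * r x) * w x ≤ |2 * S x * (q x * r x) * w x| := le_abs_self _
        _ = 2 * (|q x * r x| * (|S x| * |w x|)) := by
          rw [abs_mul, abs_mul, abs_mul, abs_two]; ring
        _ ≤ 2 * (Q * ((w x ^ 2 + S x ^ 2) / 2)) := by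
          gcongr
          exact hQ x
        _ = _ := by ring
    have i6 : -(2 * μ) * (S' x ^ 2 / r x) ≤ -(μ / M) * S' x ^ 2 := by
      have := mul_le_mul_of_nonneg_left i1 (by positivity : 0 ≤ 2 * μ)
      have e3 : 2 * μ * (S' x ^ 2 / (2 * M)) = μ / M * S' x ^ 2 := by field_simp
      linarith
    have e4 : 3 * μ / (4 * M) * S' x ^ 2 = μ / M * S' x ^ 2 - μ / (4 * M) * S' x ^ 2 := by
      field_simp; ring
    rw [e1]
    linarith
  have hint := intervalIntegral.integral_mono_on (μ := volume) zero_le_one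
    (Continuous.intervalIntegrable (by fun_prop) _ _)
    (Continuous.intervalIntegrable (by fun_prop) _ _) hpt
  rw [intervalIntegral.integral_add, intervalIntegral.integral_add, intervalIntegral.integral_add,
    intervalIntegral.integral_add, h0] at hint
  · simp only [intervalIntegral.integral_const_mul] at hint
    rw [← hG] at hint
    refine hint.trans ?_
    have j1 := mul_le_mul_of_nonneg_left hE (by positivity : 0 ≤ 4 * M * μ * γ ^ 2)
    have j2 := mul_le_mul_of_nonneg_left hN (by positivity : 0 ≤ 2 * μ * B + B / 2 + Q)
    have j3 := mul_le_mul_of_nonneg_left hL (by positivity : 0 ≤ B / 2 + Q)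
    have j4 : B * (2 * μ * N + (N + L) / 2)
        ≤ μ / (8 * M) * (2 * L + 2 * G) + 2 * M / μ * (2 * μ * N + (N + L) / 2) ^ 2 := by
      rw [← hBsq]
      have : 0 ≤ μ / (8 * M) * (B - 4 * M / μ * (2 * μ * N + (N + L) / 2)) ^ 2 := by positivity
      have e5 : μ / (8 * M) * (B - 4 * M / μ * (2 * μ * N + (N + L) / 2)) ^ 2
          = μ / (8 * M) * B ^ 2 - B * (2 * μ * N + (N + L) / 2)
            + 2 * M / μ * (2 * μ * N + (N + L) / 2) ^ 2 := by
        field_simp; ring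
      linarith
    have e6 : μ / (8 * M) * (2 * L + 2 * G) = μ / (4 * M) * L + μ / (4 * M) * G := by
      field_simp; ring
    have e7 : 3 * μ / (4 * M) * G = μ / (4 * M) * G + μ / (2 * M) * G := by
      field_simp; ring
    unfold fluxRate
    linarith
  all_goals exact Continuous.intervalIntegrable (by fun_prop) _ _

/-! ### Evolution of the effective flux -/

theorem IsAdmissiblePair.contDiffOn_pressure {P : ℝ → ℝ} {γ β a : ℝ}
    (h : IsAdmissiblePair P γ β a) : ContDiffOn ℝ 1 (artificialPressure P γ) (Ioi 0) :=
  (h.smooth.mono Ioi_subset_Ici_self).add (by fun_prop)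

theorem IsAdmissiblePair.hasDerivAt_pressure {P : ℝ → ℝ} {γ β a : ℝ}
    (h : IsAdmissiblePair P γ β a) {r : ℝ} (hr : 0 < r) :
    HasDerivAt (artificialPressure P γ) (deriv (artificialPressure P γ) r) r :=
  ((h.contDiffOn_pressure.differentiableOn one_ne_zero r hr).differentiableAt
    (Ioi_mem_nhds hr)).hasDerivAt

theorem IsAdmissiblePair.continuousOn_deriv_pressure {P : ℝ → ℝ} {γ β a : ℝ}
    (h : IsAdmissiblePair P γ β a) :
    ContinuousOn (deriv (artificialPressure P γ)) (Ioi 0) :=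
  h.contDiffOn_pressure.continuousOn_deriv_of_isOpen isOpen_Ioi le_rfl

theorem IsAdmissiblePair.hasDerivAt {P : ℝ → ℝ} {γ β a : ℝ}
    (h : IsAdmissiblePair P γ β a) {r : ℝ} (hr : 0 < r) :
    HasDerivAt P (deriv (artificialPressure P γ) r - γ * r) r := by
  have h1 := (h.hasDerivAt_pressure hr).sub (((hasDerivAt_id r).pow 2).const_mul (γ / 2))
  have e : artificialPressure P γ - (fun x => γ / 2 * (id ^ 2) x) = P := by
    ext x; simp [artificialPressure]
  rw [e] at h1
  refine h1.congr_deriv ?_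
  simp; ring

/-- Integrated form of a dissipative differential inequality. -/
theorem add_integral_le_of_deriv_le {E G : ℝ → ℝ} {ν C T : ℝ} (hE : ContinuousOn E (Ici 0))
    (hG : ContinuousOn G (Ici 0))
    (hd : ∀ t ∈ Ioo 0 T, ∃ E', HasDerivAt E E' t ∧ E' ≤ -ν * G t + C) :
    ∀ t ∈ Icc 0 T, E t + ν * (∫ s in (0 : ℝ)..t, G s) ≤ E 0 + C * t := by
  set G₁ : ℝ → ℝ := fun t => G (max t 0) with hG₁
  have cG₁ : Continuous G₁ :=
    hG.comp_continuous (by fun_prop) fun t => mem_Ici.2 (le_max_right _ _)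
  have hder : ∀ t, HasDerivAt (fun t => ∫ s in (0 : ℝ)..t, G₁ s) (G₁ t) t := fun t =>
    intervalIntegral.integral_hasDerivAt_right (cG₁.intervalIntegrable _ _)
      (cG₁.stronglyMeasurableAtFilter _ _) cG₁.continuousAt
  have hF : ∀ t ∈ Ioo 0 T, ∃ F' ≤ 0,
      HasDerivAt (fun t => E t + ν * (∫ s in (0 : ℝ)..t, G₁ s) - C * t) F' t := by
    intro t ht
    obtain ⟨E', h1, h2⟩ := hd t ht
    refine ⟨_, ?_, (h1.add ((hder t).const_mul ν)).sub ((hasDerivAt_id t).const_mul C)⟩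
    simp only [hG₁, max_eq_left ht.1.le]
    linarith
  have hanti : AntitoneOn (fun t => E t + ν * (∫ s in (0 : ℝ)..t, G₁ s) - C * t) (Icc 0 T) := by
    refine antitoneOn_of_deriv_nonpos (convex_Icc _ _) ?_ ?_ ?_
    · have c1 : Continuous fun t => ∫ s in (0 : ℝ)..t, G₁ s :=
        continuous_iff_continuousAt.2 fun t => (hder t).continuousAt
      exact ((hE.mono Icc_subset_Ici_self).add (by fun_prop)).sub (by fun_prop)
    · rw [interior_Icc]
      intro t ht
      obtain ⟨F', _, h⟩ := hF t ht
      exact h.differentiableAt.differentiableWithinAt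
    · rw [interior_Icc]
      intro t ht
      obtain ⟨F', h0, h⟩ := hF t ht
      rwa [h.deriv]
  intro t ht
  have h := hanti ⟨le_rfl, ht.1.trans ht.2⟩ ht ht.1
  have e : ∫ s in (0 : ℝ)..t, G s = ∫ s in (0 : ℝ)..t, G₁ s := by
    refine intervalIntegral.integral_congr fun s hs => ?_
    rw [uIcc_of_le ht.1] at hs
    simp only [hG₁, max_eq_left hs.1]
  rw [e]
  simp only [intervalIntegral.integral_same] at h
  linarith

section Flux

variable {μ κ γ β a M : ℝ} {P ρ₀ u₀ : ℝ → ℝ} {ρ u c : ℝ → ℝ → ℝ}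

/-- The effective flux `μ ∂ₓu − P_γ(ρ)`. -/
noncomputable def effectiveFlux (μ γ : ℝ) (P : ℝ → ℝ) (ρ u : ℝ → ℝ → ℝ) (t x : ℝ) : ℝ :=
  μ * deriv (u t) x - artificialPressure P γ (ρ t x)

/-- The space derivative of the effective flux. -/
noncomputable def effectiveFluxDeriv (μ γ : ℝ) (P : ℝ → ℝ) (ρ u : ℝ → ℝ → ℝ) (t x : ℝ) : ℝ :=
  μ * deriv (deriv (u t)) x - deriv (artificialPressure P γ) (ρ t x) * deriv (ρ t) x

theorem IsNSKSolution.continuousOn_comp_rho (hs : IsNSKSolution μ κ γ P (Ici 0) ρ u c ρ₀ u₀)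
    {g : ℝ → ℝ} (hg : ContinuousOn g (Ioi 0)) :
    ContinuousOn (fun p : ℝ × ℝ => g (ρ p.1 p.2)) (Ici 0 ×ˢ univ) :=
  hg.comp hs.smooth_rho.continuousOn fun _ _ => hs.rho_pos _ _

theorem IsNSKSolution.continuousOn_effectiveFlux
    (hs : IsNSKSolution μ κ γ P (Ici 0) ρ u c ρ₀ u₀) (hP : IsAdmissiblePair P γ β a) :
    ContinuousOn (fun p : ℝ × ℝ => effectiveFlux μ γ P ρ u p.1 p.2) (Ici 0 ×ˢ univ) :=
  (continuousOn_const.mul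
    (contDiffOn_deriv_space (uniqueDiffOn_Ici 0) hs.smooth_u).continuousOn).sub
    (hs.continuousOn_comp_rho hP.contDiffOn_pressure.continuousOn)

theorem IsNSKSolution.continuousOn_effectiveFluxDeriv
    (hs : IsNSKSolution μ κ γ P (Ici 0) ρ u c ρ₀ u₀) (hP : IsAdmissiblePair P γ β a) :
    ContinuousOn (fun p : ℝ × ℝ => effectiveFluxDeriv μ γ P ρ u p.1 p.2) (Ici 0 ×ˢ univ) :=
  (continuousOn_const.mul (contDiffOn_deriv_space (f := fun t => deriv (u t)) (uniqueDiffOn_Ici 0)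
    (contDiffOn_deriv_space (uniqueDiffOn_Ici 0) hs.smooth_u)).continuousOn).sub
    ((hs.continuousOn_comp_rho hP.continuousOn_deriv_pressure).mul
      (contDiffOn_deriv_space (uniqueDiffOn_Ici 0) hs.smooth_rho).continuousOn)

theorem IsNSKSolution.hasDerivAt_effectiveFlux
    (hs : IsNSKSolution μ κ γ P (Ici 0) ρ u c ρ₀ u₀) (hP : IsAdmissiblePair P γ β a)
    {t : ℝ} (ht : 0 ≤ t) (x : ℝ) :
    HasDerivAt (effectiveFlux μ γ P ρ u t) (effectiveFluxDeriv μ γ P ρ u t x) x :=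
  ((hasDerivAt_space (f := fun t => deriv (u t))
    (contDiffOn_deriv_space (uniqueDiffOn_Ici 0) hs.smooth_u) ht x).const_mul μ).sub
    ((hP.hasDerivAt_pressure (hs.rho_pos t x)).comp x (hasDerivAt_space hs.smooth_rho ht x))

/-- The differential inequality for the `L²` norm of the effective flux. -/
theorem IsNSKSolution.exists_hasDerivAt_integral_sq_effectiveFlux
    (hs : IsNSKSolution μ κ γ P (Ici 0) ρ u c ρ₀ u₀) (hP : IsAdmissiblePair P γ β a)
    (hμ : 0 < μ) (hκ : 0 < κ) (hγ : 0 < γ) (hM : 0 < M) {Q N L t : ℝ} (ht : 0 < t)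
    (hrM : ∀ x, ρ t x ≤ 2 * M)
    (hQ : ∀ x, |deriv (artificialPressure P γ) (ρ t x) * ρ t x| ≤ Q)
    (hN : ∫ x in (0 : ℝ)..1, deriv (u t) x ^ 2 ≤ N)
    (hL : ∫ x in (0 : ℝ)..1, effectiveFlux μ γ P ρ u t x ^ 2 ≤ L) :
    ∃ E', HasDerivAt (fun t => ∫ x in (0 : ℝ)..1, effectiveFlux μ γ P ρ u t x ^ 2) E' t ∧
      E' ≤ -(μ / (2 * M)) * (∫ x in (0 : ℝ)..1, effectiveFluxDeriv μ γ P ρ u t x ^ 2)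
        + fluxRate μ κ γ M Q N L := by
  have hsub : (Ioi (0 : ℝ)) ×ˢ (univ : Set ℝ) ⊆ Ici 0 ×ˢ univ :=
    prod_mono Ioi_subset_Ici_self subset_rfl
  have su := hs.smooth_u.mono hsub
  have sρ := hs.smooth_rho.mono hsub
  have sc := hs.smooth_c.mono hsub
  have uI : UniqueDiffOn ℝ (Ioi (0 : ℝ)) := isOpen_Ioi.uniqueDiffOn
  have sux := contDiffOn_deriv_space uI su
  have suxx := contDiffOn_deriv_space (f := fun t => deriv (u t)) uI sux
  have scx := contDiffOn_deriv_space uI sc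
  have scxx := contDiffOn_deriv_space (f := fun t => deriv (c t)) uI scx
  have sut := contDiffOn_deriv_time isOpen_Ioi su
  have sutx := contDiffOn_deriv_space (f := fun t x => deriv (fun s => u s x) t) uI sut
  have sρt := contDiffOn_deriv_time isOpen_Ioi sρ
  have cS := (hs.continuousOn_effectiveFlux hP).mono hsub
  have cS' := (hs.continuousOn_effectiveFluxDeriv hP).mono hsub
  have cq := (hs.continuousOn_comp_rho hP.continuousOn_deriv_pressure).mono hsub
  have hmass : ∀ x, deriv (fun s => ρ s x) t = -(deriv (ρ t) x * u t x + ρ t x * deriv (u t) x) := by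
    intro x
    have h := hs.mass t ht.le x
    have e : deriv (fun y => ρ t y * u t y) x = deriv (ρ t) x * u t x + ρ t x * deriv (u t) x :=
      ((hasDerivAt_space sρ ht x).mul (hasDerivAt_space su ht x)).deriv
    rw [e] at h
    linarith
  have hmom : ∀ x, ρ t x * (deriv (fun s => u s x) t + u t x * deriv (u t) x)
      = effectiveFluxDeriv μ γ P ρ u t x + γ * ρ t x * deriv (c t) x := by
    intro x
    have h := hs.momentum t ht.le x
    have dρ := hasDerivAt_space sρ ht x
    have du := hasDerivAt_space su ht x
    have e1 : deriv (fun s => ρ s x * u s x) t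
        = deriv (fun s => ρ s x) t * u t x + ρ t x * deriv (fun s => u s x) t :=
      ((hasDerivAt_time isOpen_Ioi sρ ht x).mul (hasDerivAt_time isOpen_Ioi su ht x)).deriv
    have e2 : deriv (fun y => ρ t y * u t y ^ 2) x
        = deriv (ρ t) x * u t x ^ 2 + ρ t x * (2 * u t x * deriv (u t) x) := by
      have := (dρ.mul (du.pow 2)).deriv
      refine this.trans ?_
      simp
    have e3 : deriv (fun y => P (ρ t y)) x
        = (deriv (artificialPressure P γ) (ρ t x) - γ * ρ t x) * deriv (ρ t) x :=
      ((hP.hasDerivAt (hs.rho_pos t x)).comp x dρ).deriv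
    have e4 : deriv (fun y => c t y - ρ t y) x = deriv (c t) x - deriv (ρ t) x :=
      ((hasDerivAt_space sc ht x).sub dρ).deriv
    rw [e1, e2, e3, e4, hmass x] at h
    unfold effectiveFluxDeriv
    linarith
  have hdt : ∀ s, 0 < s → ∀ x, HasDerivAt (fun s => effectiveFlux μ γ P ρ u s x ^ 2)
      (2 * effectiveFlux μ γ P ρ u s x * (μ * deriv (fun y => deriv (fun s => u s y) s) x
        - deriv (artificialPressure P γ) (ρ s x) * deriv (fun s => ρ s x) s)) s := by
    intro s hs' x
    have h1 := hasDerivAt_time (f := fun t => deriv (u t)) isOpen_Ioi sux hs' x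
    rw [deriv_time_deriv_space isOpen_Ioi su hs' x] at h1
    have h2 := (hP.hasDerivAt_pressure (hs.rho_pos s x)).comp s
      (hasDerivAt_time isOpen_Ioi sρ hs' x)
    refine (((h1.const_mul μ).sub h2).pow 2).congr_deriv ?_
    simp [effectiveFlux]
  have hE := hasDerivAt_integral_period
    (f := fun t x => effectiveFlux μ γ P ρ u t x ^ 2) (cS.pow 2)
    ((continuousOn_const.mul cS).mul ((continuousOn_const.mul sutx.continuousOn).sub
      (cq.mul sρt.continuousOn))) hdt ht
  refine ⟨_, hE, ?_⟩
  refine le_trans (le_of_eq ?_) (integral_flux_production_le (M := M) (Q := Q) (N := N) (L := L)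
    hμ hκ hγ hM (r := ρ t) (q := fun x => deriv (artificialPressure P γ) (ρ t x)) (v := u t)
    (w := deriv (u t)) (w' := deriv (deriv (u t))) (S := effectiveFlux μ γ P ρ u t)
    (S' := effectiveFluxDeriv μ γ P ρ u t) (b := fun x => deriv (fun s => u s x) t)
    (b' := deriv fun x => deriv (fun s => u s x) t) (c := c t) (c' := deriv (c t))
    (c'' := deriv (deriv (c t))) (hs.rho_pos t) hrM hQ
    (continuous_slice sρ.continuousOn ht)
    (continuous_slice (f := fun t x => deriv (artificialPressure P γ) (ρ t x)) cq ht)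
    (hasDerivAt_space su ht) (hasDerivAt_space (f := fun t => deriv (u t)) sux ht)
    (continuous_slice (f := fun t => deriv (deriv (u t))) suxx.continuousOn ht)
    (hs.hasDerivAt_effectiveFlux hP ht.le) (continuous_slice cS' ht)
    (hasDerivAt_space (f := fun t x => deriv (fun s => u s x) t) sut ht)
    (continuous_slice (f := fun t => deriv fun x => deriv (fun s => u s x) t)
      sutx.continuousOn ht)
    (hasDerivAt_space sc ht) (hasDerivAt_space (f := fun t => deriv (c t)) scx ht)
    (continuous_slice (f := fun t => deriv (deriv (c t))) scxx.continuousOn ht)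
    (hs.periodic_u t) (deriv_periodic (hs.periodic_u t)) ?_ ?_ (hs.periodic_c t)
    (deriv_periodic (hs.periodic_c t)) (hs.elliptic t ht.le) hmom hN hL)
  · refine intervalIntegral.integral_congr fun x _ => ?_
    simp only [hmass x, effectiveFluxDeriv]
    ring
  · intro x
    simp only [effectiveFlux, deriv_periodic (hs.periodic_u t), hs.periodic_rho]
  · intro x
    simp only [hs.periodic_u]

end Flux

/-! ### The lifespan -/

theorem le_biSup_of_bounded {s : Set ℝ} {g : ℝ → ℝ} {D : ℝ} (hD : ∀ t ∈ s, g t ≤ D) {t : ℝ}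
    (ht : t ∈ s) : g t ≤ ⨆ t ∈ s, g t := by
  have hb : BddAbove (range fun t => ⨆ _ : t ∈ s, g t) := by
    refine ⟨max D 0, ?_⟩
    rintro _ ⟨t, rfl⟩
    exact Real.iSup_le (fun h => (hD t h).trans (le_max_left _ _)) (le_max_right _ _)
  refine le_ciSup_of_le hb t ?_
  rw [ciSup_pos ht]

theorem abs_le_sSup_image {g : ℝ → ℝ} {a b : ℝ} (hg : ContinuousOn g (Icc a b)) {l : ℝ}
    (hl : l ∈ Icc a b) : |g l| ≤ sSup ((fun l => |g l|) '' Icc a b) :=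
  le_csSup (isCompact_Icc.image_of_continuousOn hg.abs).bddAbove (mem_image_of_mem _ hl)

/-- The maximum of `|P_γ|` over the admissible densities. -/
noncomputable def pressureBound (P : ℝ → ℝ) (γ M : ℝ) : ℝ :=
  sSup ((fun l => |artificialPressure P γ l|) '' Icc (2 * M)⁻¹ (2 * M))

/-- The maximum of `|P_γ'(l) l|` over the admissible densities. -/
noncomputable def pressureDerivBound (P : ℝ → ℝ) (γ M : ℝ) : ℝ :=
  sSup ((fun l => |deriv (artificialPressure P γ) l * l|) '' Icc (2 * M)⁻¹ (2 * M))

/-- A priori bound for `‖∂ₓu‖²` in terms of the size `h` of the initial velocity in `H¹`. -/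
noncomputable def velocityBound (μ γ M h : ℝ) (P : ℝ → ℝ) : ℝ :=
  8 / μ ^ 2 * (2 + 5 * M * μ)
    * (2 * μ ^ 2 * h ^ 2 + 2 * pressureBound P γ M ^ 2 + 1 + pressureBound P γ M ^ 2)

/-- A priori rate of growth of the squared `L²` norm of the effective flux. -/
noncomputable def fluxGrowth (M h μ γ κ : ℝ) (P : ℝ → ℝ) : ℝ :=
  fluxRate μ κ γ M (pressureDerivBound P γ M) (velocityBound μ γ M h P)
    (2 * μ ^ 2 * velocityBound μ γ M h P + 2 * pressureBound P γ M ^ 2)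

theorem fluxGrowth_nonneg {M h μ γ κ : ℝ} (P : ℝ → ℝ) (hM : 0 < M) (hμ : 0 < μ) (hγ : 0 < γ)
    (hκ : 0 < κ) : 0 ≤ fluxGrowth M h μ γ κ P := by
  have hQ : 0 ≤ pressureDerivBound P γ M := by
    refine Real.sSup_nonneg ?_
    rintro _ ⟨l, _, rfl⟩
    exact abs_nonneg _
  have hN : 0 ≤ velocityBound μ γ M h P := by
    unfold velocityBound
    positivity
  unfold fluxGrowth fluxRate
  positivity

theorem integral_sq_flux_le {w p S : ℝ → ℝ} {μ K : ℝ} (cw : Continuous w) (cS : Continuous S)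
    (hp : ∀ x, |p x| ≤ K) (hS : ∀ x, S x = μ * w x - p x) :
    ∫ x in (0 : ℝ)..1, S x ^ 2 ≤ 2 * μ ^ 2 * (∫ x in (0 : ℝ)..1, w x ^ 2) + 2 * K ^ 2 := by
  have hpt : ∀ x ∈ Icc (0 : ℝ) 1, S x ^ 2 ≤ 2 * μ ^ 2 * w x ^ 2 + 2 * K ^ 2 := fun x _ => by
    have h1 := sq_le_sq' (abs_le.1 (hp x)).1 (abs_le.1 (hp x)).2
    rw [hS]
    nlinarith [sq_nonneg (μ * w x + p x)]
  have := intervalIntegral.integral_mono_on (μ := volume) zero_le_one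
    (Continuous.intervalIntegrable (by fun_prop) _ _)
    (Continuous.intervalIntegrable (by fun_prop) _ _) hpt
  rw [intervalIntegral.integral_add (Continuous.intervalIntegrable (by fun_prop) _ _)
    (Continuous.intervalIntegrable (by fun_prop) _ _), intervalIntegral.integral_const_mul] at this
  simpa using this

theorem integral_sq_le_flux {w p S : ℝ → ℝ} {μ K : ℝ} (hμ : 0 < μ) (cw : Continuous w)
    (cS : Continuous S) (hp : ∀ x, |p x| ≤ K) (hS : ∀ x, S x = μ * w x - p x) :
    ∫ x in (0 : ℝ)..1, w x ^ 2 ≤ 2 / μ ^ 2 * ((∫ x in (0 : ℝ)..1, S x ^ 2) + K ^ 2) := by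
  have h := integral_sq_flux_le (w := S) (p := fun x => -(p x) / μ) (S := w) (μ := 1 / μ)
    (K := K / μ) cS cw (fun x => ?_) (fun x => ?_)
  · refine h.trans_eq ?_
    field_simp
  · rw [abs_div, abs_neg, abs_of_pos hμ]
    gcongr
    exact hp x
  · rw [hS]
    field_simp
    ring

theorem IsNSKSolution.refined_bound {μ κ γ β a M : ℝ} {P ρ₀ u₀ : ℝ → ℝ} {ρ u c : ℝ → ℝ → ℝ}
    (hs : IsNSKSolution μ κ γ P (Ici 0) ρ u c ρ₀ u₀) (hP : IsAdmissiblePair P γ β a)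
    (hμ : 0 < μ) (hκ : 0 < κ) (hγ : 0 < γ) (hM : 0 < M) {T : ℝ} (hT : 0 < T)
    (hρ : ∀ t ∈ Icc 0 T, ∀ x, ρ t x ∈ Icc (2 * M)⁻¹ (2 * M))
    (hbound : (⨆ t ∈ Icc 0 T, ∫ x in (0 : ℝ)..1, deriv (u t) x ^ 2)
        + (∫ t in (0 : ℝ)..T, ∫ x in (0 : ℝ)..1, effectiveFluxDeriv μ γ P ρ u t x ^ 2)
      ≤ 8 / μ ^ 2 * (2 + 5 * M * μ) * ((∫ x in (0 : ℝ)..1, effectiveFlux μ γ P ρ u 0 x ^ 2) + 1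
        + pressureBound P γ M ^ 2))
    (hTu : T < 1 / (fluxGrowth M (H1norm u₀) μ γ κ P + 1)) :
    (⨆ t ∈ Icc 0 T, ∫ x in (0 : ℝ)..1, deriv (u t) x ^ 2)
        + (∫ t in (0 : ℝ)..T, ∫ x in (0 : ℝ)..1, effectiveFluxDeriv μ γ P ρ u t x ^ 2)
      ≤ 4 / μ ^ 2 * (2 + 5 * M * μ) * ((∫ x in (0 : ℝ)..1, effectiveFlux μ γ P ρ u 0 x ^ 2) + 1
        + pressureBound P γ M ^ 2) := by
  set K := pressureBound P γ M with hK
  set C := fluxGrowth M (H1norm u₀) μ γ κ P with hC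
  have hC0 : 0 ≤ C := fluxGrowth_nonneg P hM hμ hγ hκ
  have hIcc : Icc (2 * M)⁻¹ (2 * M) ⊆ Ioi 0 := fun r hr =>
    lt_of_lt_of_le (by positivity : (0 : ℝ) < (2 * M)⁻¹) hr.1
  have hpK : ∀ t ∈ Icc 0 T, ∀ x, |artificialPressure P γ (ρ t x)| ≤ K := fun t ht x =>
    abs_le_sSup_image (hP.contDiffOn_pressure.continuousOn.mono hIcc) (hρ t ht x)
  have hpQ : ∀ t ∈ Icc 0 T, ∀ x,
      |deriv (artificialPressure P γ) (ρ t x) * ρ t x| ≤ pressureDerivBound P γ M := fun t ht x =>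
    abs_le_sSup_image (g := fun l => deriv (artificialPressure P γ) l * l)
      ((hP.continuousOn_deriv_pressure.mono hIcc).mul continuousOn_id) (hρ t ht x)
  have sux := contDiffOn_deriv_space (uniqueDiffOn_Ici 0) hs.smooth_u
  have cux : ∀ t, 0 ≤ t → Continuous (deriv (u t)) := fun t ht =>
    continuous_slice (f := fun t => deriv (u t)) sux.continuousOn ht
  have cS := hs.continuousOn_effectiveFlux hP
  have cS' := hs.continuousOn_effectiveFluxDeriv hP
  have cSt : ∀ t, 0 ≤ t → Continuous (effectiveFlux μ γ P ρ u t) := fun t ht =>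
    continuous_slice cS ht
  have cW : ContinuousOn (fun t => ∫ x in (0 : ℝ)..1, deriv (u t) x ^ 2) (Ici 0) :=
    continuousOn_integral_period (f := fun t x => deriv (u t) x ^ 2) (sux.continuousOn.pow 2)
  have cE : ContinuousOn (fun t => ∫ x in (0 : ℝ)..1, effectiveFlux μ γ P ρ u t x ^ 2) (Ici 0) :=
    continuousOn_integral_period (f := fun t x => effectiveFlux μ γ P ρ u t x ^ 2) (cS.pow 2)
  have cG : ContinuousOn
      (fun t => ∫ x in (0 : ℝ)..1, effectiveFluxDeriv μ γ P ρ u t x ^ 2) (Ici 0) :=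
    continuousOn_integral_period (f := fun t x => effectiveFluxDeriv μ γ P ρ u t x ^ 2) (cS'.pow 2)
  have hsqnn : ∀ g : ℝ → ℝ, 0 ≤ ∫ x in (0 : ℝ)..1, g x ^ 2 := fun g =>
    intervalIntegral.integral_nonneg zero_le_one fun _ _ => sq_nonneg _
  have hGnn : 0 ≤ ∫ t in (0 : ℝ)..T, ∫ x in (0 : ℝ)..1, effectiveFluxDeriv μ γ P ρ u t x ^ 2 :=
    intervalIntegral.integral_nonneg hT.le fun _ _ => hsqnn _
  have h0T : (0 : ℝ) ∈ Icc 0 T := ⟨le_rfl, hT.le⟩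
  have hu₀ : u₀ = u 0 := funext fun x => (hs.init_u x).symm
  have hH1 : ∫ x in (0 : ℝ)..1, deriv (u 0) x ^ 2 ≤ H1norm u₀ ^ 2 := by
    have c0 : Continuous (u 0) := continuous_slice hs.smooth_u.continuousOn (mem_Ici.2 le_rfl)
    have c1 := cux 0 le_rfl
    rw [H1norm, Real.sq_sqrt (intervalIntegral.integral_nonneg zero_le_one
      fun _ _ => by positivity), hu₀]
    exact intervalIntegral.integral_mono_on zero_le_one
      (Continuous.intervalIntegrable (by fun_prop) _ _)
      (Continuous.intervalIntegrable (by fun_prop) _ _)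
      fun x _ => le_add_of_nonneg_left (sq_nonneg _)
  have hinit : ∫ x in (0 : ℝ)..1, effectiveFlux μ γ P ρ u 0 x ^ 2
      ≤ 2 * μ ^ 2 * H1norm u₀ ^ 2 + 2 * K ^ 2 := by
    refine (integral_sq_flux_le (cux 0 le_rfl) (cSt 0 le_rfl) (hpK 0 h0T) fun x => rfl).trans ?_
    gcongr
  obtain ⟨D, hD⟩ := isCompact_Icc.exists_bound_of_continuousOn
    (cW.mono (Icc_subset_Ici_self : Icc 0 T ⊆ Ici 0))
  have hN : ∀ t ∈ Icc 0 T, ∫ x in (0 : ℝ)..1, deriv (u t) x ^ 2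
      ≤ velocityBound μ γ M (H1norm u₀) P := by
    intro t ht
    have h1 := le_biSup_of_bounded (g := fun t => ∫ x in (0 : ℝ)..1, deriv (u t) x ^ 2)
      (fun t ht => (le_abs_self _).trans (hD t ht)) ht
    refine (h1.trans ((le_add_of_nonneg_right hGnn).trans hbound)).trans ?_
    unfold velocityBound
    rw [← hK]
    gcongr
  have hL : ∀ t ∈ Icc 0 T, ∫ x in (0 : ℝ)..1, effectiveFlux μ γ P ρ u t x ^ 2
      ≤ 2 * μ ^ 2 * velocityBound μ γ M (H1norm u₀) P + 2 * K ^ 2 := by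
    intro t ht
    refine (integral_sq_flux_le (cux t ht.1) (cSt t ht.1) (hpK t ht) fun x => rfl).trans ?_
    gcongr
    exact hN t ht
  have henergy := add_integral_le_of_deriv_le (ν := μ / (2 * M)) (C := C) (T := T) cE cG
    fun t ht => hs.exists_hasDerivAt_integral_sq_effectiveFlux hP hμ hκ hγ hM ht.1
      (fun x => (hρ t (Ioo_subset_Icc_self ht) x).2) (hpQ t (Ioo_subset_Icc_self ht))
      (hN t (Ioo_subset_Icc_self ht)) (hL t (Ioo_subset_Icc_self ht))
  have hCT : C * T ≤ 1 := by
    rw [lt_div_iff₀ (by positivity)] at hTu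
    nlinarith
  set A := ∫ x in (0 : ℝ)..1, effectiveFlux μ γ P ρ u 0 x ^ 2 with hA
  have hA0 : 0 ≤ A := hsqnn _
  have hCt : ∀ t ∈ Icc 0 T, C * t ≤ 1 := fun t ht =>
    (mul_le_mul_of_nonneg_left ht.2 hC0).trans hCT
  have hsup : (⨆ t ∈ Icc 0 T, ∫ x in (0 : ℝ)..1, deriv (u t) x ^ 2)
      ≤ 2 / μ ^ 2 * (A + 1 + K ^ 2) := by
    refine Real.iSup_le (fun t => Real.iSup_le (fun ht => ?_) (by positivity)) (by positivity)
    refine (integral_sq_le_flux hμ (cux t ht.1) (cSt t ht.1) (hpK t ht) fun x => rfl).trans ?_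
    have h1 := henergy t ht
    have h2 : 0 ≤ μ / (2 * M)
        * ∫ s in (0 : ℝ)..t, ∫ x in (0 : ℝ)..1, effectiveFluxDeriv μ γ P ρ u s x ^ 2 :=
      mul_nonneg (by positivity) (intervalIntegral.integral_nonneg ht.1 fun _ _ => hsqnn _)
    have h3 := hCt t ht
    gcongr
    linarith
  have hint : ∫ t in (0 : ℝ)..T, ∫ x in (0 : ℝ)..1, effectiveFluxDeriv μ γ P ρ u t x ^ 2
      ≤ 2 * M / μ * (A + 1) := by
    have h1 := henergy T ⟨hT.le, le_rfl⟩
    have h2 := hsqnn (effectiveFlux μ γ P ρ u T)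
    have h3 : μ / (2 * M)
        * ∫ t in (0 : ℝ)..T, ∫ x in (0 : ℝ)..1, effectiveFluxDeriv μ γ P ρ u t x ^ 2 ≤ A + 1 := by
      linarith
    have h4 := mul_le_mul_of_nonneg_left h3 (by positivity : 0 ≤ 2 * M / μ)
    refine le_trans (le_of_eq ?_) h4
    field_simp
  refine (add_le_add hsup hint).trans ?_
  have e : 4 / μ ^ 2 * (2 + 5 * M * μ) * (A + 1 + K ^ 2)
      = 2 / μ ^ 2 * (A + 1 + K ^ 2) + 2 * M / μ * (A + 1) + (6 / μ ^ 2 * (A + 1 + K ^ 2)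
        + 18 * M / μ * (A + 1) + 20 * M / μ * K ^ 2) := by
    field_simp; ring
  rw [e]
  exact le_add_of_nonneg_right (by positivity)

/-- Second refinement lemma: under the a-priori bounds `(2M₀)⁻¹ ≤ ρ ≤ 2M₀` and the
`K_u`-bound for `∂ₓu` and `∂ₓΣ` on `[0, T̃₀]` with `T̃₀ ∈ (0,1)`, there is `T_u > 0`,
depending only on `M₀`, `‖u₀‖_{H¹}`, `μ`, `γ`, `κ`, `P` and `W`, such that if
`T̃₀ < T_u` then the sharper bound
`sup_{[0,T̃₀]} ‖∂ₓu‖²_{L²} + ∫₀^{T̃₀} ‖∂ₓΣ‖²_{L²} ≤ (4/μ²)(2+5M₀μ)(‖Σ₀‖²_{L²}+1+K²_{P_γ})`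
holds. -/
theorem refined_effective_flux_bound :
    ∃ Tu : ℝ → ℝ → ℝ → ℝ → ℝ → (ℝ → ℝ) → (ℝ → ℝ) → ℝ,
      ∀ (μ κ γ M₀ β a : ℝ) (P W : ℝ → ℝ) (ρ u c : ℝ → ℝ → ℝ) (ρ₀ u₀ : ℝ → ℝ),
        0 < μ → 0 < κ → 0 < γ → 0 < M₀ →
        IsAdmissiblePair P γ β a → IsPressurePotential P W →
        IsNSKSolution μ κ γ P (Set.Ici 0) ρ u c ρ₀ u₀ →
        (∀ x : ℝ, M₀⁻¹ ≤ ρ₀ x ∧ ρ₀ x ≤ M₀) →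
        0 < Tu M₀ (H1norm u₀) μ γ κ P W ∧
        ∀ T₀' ∈ Set.Ioo (0:ℝ) 1,
          (∀ t ∈ Set.Icc 0 T₀', ∀ x : ℝ, (2 * M₀)⁻¹ ≤ ρ t x ∧ ρ t x ≤ 2 * M₀) →
          ((⨆ t ∈ Set.Icc 0 T₀', L2norm (fun x => deriv (u t) x) ^ 2)
              + (∫ t in (0:ℝ)..T₀',
                  L2norm (fun x =>
                    deriv (fun y => μ * deriv (u t) y - artificialPressure P γ (ρ t y)) x) ^ 2)
            ≤ 8 / μ ^ 2 * (2 + 5 * M₀ * μ)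
                * (L2norm (fun x => μ * deriv u₀ x - artificialPressure P γ (ρ₀ x)) ^ 2 + 1
                  + (sSup ((fun l => |artificialPressure P γ l|)
                      '' Set.Icc (2 * M₀)⁻¹ (2 * M₀))) ^ 2)) →
          T₀' < Tu M₀ (H1norm u₀) μ γ κ P W →
          (⨆ t ∈ Set.Icc 0 T₀', L2norm (fun x => deriv (u t) x) ^ 2)
              + (∫ t in (0:ℝ)..T₀',
                  L2norm (fun x =>
                    deriv (fun y => μ * deriv (u t) y - artificialPressure P γ (ρ t y)) x) ^ 2)
            ≤ 4 / μ ^ 2 * (2 + 5 * M₀ * μ)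
                * (L2norm (fun x => μ * deriv u₀ x - artificialPressure P γ (ρ₀ x)) ^ 2 + 1
                  + (sSup ((fun l => |artificialPressure P γ l|)
                      '' Set.Icc (2 * M₀)⁻¹ (2 * M₀))) ^ 2) := by
  refine ⟨fun M₀ h μ γ κ P _ => 1 / (fluxGrowth M₀ h μ γ κ P + 1), ?_⟩
  intro μ κ γ M₀ β a P W ρ u c ρ₀ u₀ hμ hκ hγ hM hP _ hs _
  have hC0 := fluxGrowth_nonneg (h := H1norm u₀) P hM hμ hγ hκ
  refine ⟨by positivity, fun T hT hρ hbound hTu => ?_⟩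
  have hu₀ : u₀ = u 0 := funext fun x => (hs.init_u x).symm
  have hρ₀ : ρ₀ = ρ 0 := funext fun x => (hs.init_rho x).symm
  have e : ∫ t in (0 : ℝ)..T, (∫ x in (0 : ℝ)..1,
      deriv (fun y => μ * deriv (u t) y - artificialPressure P γ (ρ t y)) x ^ 2)
      = ∫ t in (0 : ℝ)..T, ∫ x in (0 : ℝ)..1, effectiveFluxDeriv μ γ P ρ u t x ^ 2 := by
    refine intervalIntegral.integral_congr fun t ht => ?_
    rw [uIcc_of_le hT.1.le] at ht
    refine intervalIntegral.integral_congr fun x _ => ?_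
    exact congrArg (· ^ 2) (hs.hasDerivAt_effectiveFlux hP ht.1 x).deriv
  simp only [L2norm_sq, e] at hbound ⊢
  have key := hs.refined_bound hP hμ hκ hγ hM hT.1 hρ
  simp only [hu₀, hρ₀] at hbound hTu key ⊢
  exact key hbound hTu
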